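/- Let 0 < a < d, 1 < r < ∞ and p = rd/(d−a). Then: (a) for every 1 < q < ∞ and every measurable f on ℝ^d, (Σ_{l∈ℤ} [∫_{𝔄_l} |f(x)|^r |x|^{−a} dx]^{q/r})^{1/q} ≤ C ‖f‖_{L^{p,q}}; and (b) sup_{l∈ℤ} (∫_{𝔄_l} |f(x)|^r |x|^{−a} dx)^{1/r} ≤ C ‖f‖_{L^{p,∞}}; with C depending only on a, r, q, d. -/

import Mathlib

open MeasureTheory Filter Set Complex
open scoped ENNReal NNReal Topology

noncomputable section

abbrev Ed (d : ℕ) : Type := EuclideanSpace ℝ (Fin d)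

/-- dyadic annulus `{2^l ≤ |x| < 2^{l+1}}` -/
def annulus (d : ℕ) (l : ℤ) : Set (Ed d) := {x | (2:ℝ) ^ l ≤ ‖x‖ ∧ ‖x‖ < (2:ℝ) ^ (l + 1)}

/-- distribution function -/
def distribFn {α : Type*} [MeasurableSpace α] (μ : Measure α) (f : α → ℂ) (s : ℝ≥0∞) : ℝ≥0∞ :=
  μ {x | s < (‖f x‖₊ : ℝ≥0∞)}

/-- decreasing rearrangement -/
def rearrangement {α : Type*} [MeasurableSpace α] (μ : Measure α) (f : α → ℂ) (t : ℝ) : ℝ≥0∞ :=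
  sInf {s : ℝ≥0∞ | distribFn μ f s ≤ ENNReal.ofReal t}

/-- Lorentz quasinorm `L^{p,q}` -/
def lorentzNorm {α : Type*} [MeasurableSpace α] (μ : Measure α) (p : ℝ) (q : ℝ≥0∞)
    (f : α → ℂ) : ℝ≥0∞ :=
  if q = ∞ then ⨆ t : Ioi (0:ℝ), ENNReal.ofReal ((t : ℝ) ^ (1/p)) * rearrangement μ f t
  else (∫⁻ t in Ioi (0:ℝ),
    (ENNReal.ofReal (t ^ (1/p)) * rearrangement μ f t) ^ q.toReal / ENNReal.ofReal t) ^
      (1 / q.toReal)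

lemma distrib_rearr {α : Type*} [MeasurableSpace α] (μ : Measure α) (f : α → ℂ) (t : ℝ) :
    μ {x | rearrangement μ f t < (‖f x‖₊ : ℝ≥0∞)} ≤ ENNReal.ofReal t := by
  rcases eq_or_ne (rearrangement μ f t) ∞ with h | h
  · simp [h]
  · obtain ⟨u, hu1, hu2, hu3⟩ := exists_seq_strictAnti_tendsto' (lt_top_iff_ne_top.2 h)
    have hset : {x | rearrangement μ f t < (‖f x‖₊ : ℝ≥0∞)} =
        ⋃ n, {x | u n < (‖f x‖₊ : ℝ≥0∞)} := by
      ext x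
      simp only [mem_ofPred_eq, mem_iUnion]
      constructor
      · intro hx
        exact (hu3.eventually (gt_mem_nhds hx)).exists
      · rintro ⟨n, hn⟩
        exact (hu2 n).1.trans hn
    have hmono : Monotone fun n => {x | u n < (‖f x‖₊ : ℝ≥0∞)} := by
      intro m n hmn x hx
      exact lt_of_le_of_lt (hu1.antitone hmn) hx
    rw [hset, hmono.measure_iUnion]
    refine iSup_le fun n => ?_
    obtain ⟨s, hs, hsu⟩ := sInf_lt_iff.1 (hu2 n).1
    refine le_trans (measure_mono ?_) hs
    intro x hx
    exact hsu.trans hx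

lemma rearr_anti {α : Type*} [MeasurableSpace α] (μ : Measure α) (f : α → ℂ) :
    Antitone (rearrangement μ f) := by
  intro s t hst
  exact sInf_le_sInf fun x hx => le_trans hx (ENNReal.ofReal_le_ofReal hst)

/-- core estimate of an integral over a set by a sum -/
lemma core {α : Type*} [MeasurableSpace α] (μ : Measure α) (f : α → ℂ) (hf : Measurable f)
    (A : Set α) (hA : MeasurableSet A) (r : ℝ) (hr : 0 < r) (τ : ℕ → ℝ)
    (hτ : Tendsto τ atTop (𝓝 0)) (hA' : μ A ≤ ENNReal.ofReal (τ 0)) :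
    ∫⁻ x in A, (‖f x‖₊ : ℝ≥0∞) ^ r ∂μ ≤
      ∑' n : ℕ, rearrangement μ f (τ (n+1)) ^ r * ENNReal.ofReal (τ n) := by
  set s : ℕ → ℝ≥0∞ := fun n => rearrangement μ f (τ (n+1)) with hs
  let B : ℕ → Set α := fun n => match n with
    | 0 => A
    | n+1 => {x | s n < (‖f x‖₊ : ℝ≥0∞)}
  have hBm : ∀ n, MeasurableSet (B n) := by
    intro n
    cases n with
    | zero => exact hA
    | succ n => exact measurableSet_lt measurable_const (by fun_prop)
  have hB : ∀ n, μ (B n) ≤ ENNReal.ofReal (τ n) := by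
    intro n
    cases n with
    | zero => exact hA'
    | succ n => exact distrib_rearr μ f _
  have hnull : μ {x | ∀ n, s n < (‖f x‖₊ : ℝ≥0∞)} = 0 := by
    have h1 : Tendsto (fun n => ENNReal.ofReal (τ (n+1))) atTop (𝓝 0) := by
      have := (ENNReal.continuous_ofReal.tendsto 0).comp (hτ.comp (tendsto_add_atTop_nat 1))
      simpa [Function.comp_def] using this
    refine le_antisymm (ge_of_tendsto' h1 fun n => ?_) bot_le
    exact le_trans (measure_mono fun x hx => hx n) (hB (n+1))
  have hae : ∀ᵐ x ∂μ, ∃ n, (‖f x‖₊ : ℝ≥0∞) ≤ s n := by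
    rw [ae_iff]; simpa using hnull
  have hpt : ∀ᵐ x ∂(μ.restrict A), (‖f x‖₊ : ℝ≥0∞) ^ r ≤
      ∑' n, (B n).indicator (fun _ => s n ^ r) x := by
    filter_upwards [ae_restrict_of_ae hae, ae_restrict_mem hA] with x hx hxA
    classical
    let n := Nat.find hx
    have hn : (‖f x‖₊ : ℝ≥0∞) ≤ s n := Nat.find_spec hx
    have hxB : x ∈ B n := by
      rcases h : n with _ | m
      · exact hxA
      · have : ¬ ((‖f x‖₊ : ℝ≥0∞) ≤ s m) := Nat.find_min hx (show m < n by omega)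
        exact not_le.1 this
    refine le_trans ?_ (ENNReal.le_tsum n)
    rw [indicator_of_mem hxB]
    exact ENNReal.rpow_le_rpow hn hr.le
  calc ∫⁻ x in A, (‖f x‖₊ : ℝ≥0∞) ^ r ∂μ
      ≤ ∫⁻ x in A, ∑' n, (B n).indicator (fun _ => s n ^ r) x ∂μ := lintegral_mono_ae hpt
    _ ≤ ∫⁻ x, ∑' n, (B n).indicator (fun _ => s n ^ r) x ∂μ :=
        lintegral_mono' Measure.restrict_le_self le_rfl
    _ = ∑' n, ∫⁻ x, (B n).indicator (fun _ => s n ^ r) x ∂μ :=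
        lintegral_tsum fun n => (measurable_const.indicator (hBm n)).aemeasurable
    _ ≤ _ := by
        refine ENNReal.tsum_le_tsum fun n => ?_
        rw [lintegral_indicator_const (hBm n)]
        gcongr
        exact hB n

lemma conv_bound (ρ : ℝ≥0∞) (hρ : ρ < 1) (s : ℝ) (hs : 0 < s) :
    ∃ C : ℝ≥0, ∀ u : ℤ → ℝ≥0∞,
      ∑' l : ℤ, (∑' n : ℕ, ρ ^ n * u (l - 1 - n)) ^ s ≤ C * ∑' k, u k ^ s := by
  set σ : ℝ≥0∞ := ρ ^ (1/2 : ℝ) with hσ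
  have hσσ : σ * σ = ρ := by
    rw [hσ, ← ENNReal.rpow_add_of_nonneg _ _ (by norm_num) (by norm_num)]; norm_num
  have hσ1 : σ < 1 := ENNReal.rpow_lt_one hρ (by norm_num)
  have hσs1 : σ ^ s < 1 := ENNReal.rpow_lt_one hσ1 hs
  set K := ((1 - σ)⁻¹) ^ s * (1 - σ ^ s)⁻¹ with hK
  have hKfin : K ≠ ∞ := by
    refine ENNReal.mul_ne_top (ENNReal.rpow_ne_top_of_nonneg hs.le ?_) ?_
    · exact ENNReal.inv_ne_top.2 (tsub_pos_of_lt hσ1).ne'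
    · exact ENNReal.inv_ne_top.2 (tsub_pos_of_lt hσs1).ne'
  refine ⟨K.toNNReal, fun u => ?_⟩
  rw [ENNReal.coe_toNNReal hKfin]
  have h1 : ∀ l : ℤ, (∑' n : ℕ, ρ ^ n * u (l - 1 - n)) ^ s ≤
      ((1 - σ)⁻¹) ^ s * ∑' n : ℕ, (σ ^ s) ^ n * u (l - 1 - n) ^ s := by
    intro l
    set M := ∑' n : ℕ, (σ ^ s) ^ n * u (l - 1 - n) ^ s with hM
    have h2 : ∀ n : ℕ, σ ^ n * u (l - 1 - n) ≤ M ^ (1/s) := by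
      intro n
      rw [one_div, ENNReal.le_rpow_inv_iff hs, ENNReal.mul_rpow_of_nonneg _ _ hs.le]
      refine le_trans (le_of_eq ?_) (ENNReal.le_tsum n)
      clear_value σ
      rw [← ENNReal.rpow_natCast, ← ENNReal.rpow_natCast, ← ENNReal.rpow_mul, ← ENNReal.rpow_mul,
        mul_comm s]
    have h3 : ∑' n : ℕ, ρ ^ n * u (l - 1 - n) ≤ (1 - σ)⁻¹ * M ^ (1/s) := by
      rw [← ENNReal.tsum_geometric, ← ENNReal.tsum_mul_right]
      refine ENNReal.tsum_le_tsum fun n => ?_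
      rw [← hσσ, mul_pow, mul_assoc]
      gcongr
      exact h2 n
    refine (ENNReal.rpow_le_rpow h3 hs.le).trans ?_
    rw [ENNReal.mul_rpow_of_nonneg _ _ hs.le, ← ENNReal.rpow_mul, one_div_mul_cancel hs.ne',
      ENNReal.rpow_one]
  refine (ENNReal.tsum_le_tsum h1).trans ?_
  rw [ENNReal.tsum_mul_left, ENNReal.tsum_comm, hK, mul_assoc]
  gcongr
  rw [← ENNReal.tsum_geometric, ← ENNReal.tsum_mul_right]
  refine ENNReal.tsum_le_tsum fun n => ?_
  rw [ENNReal.tsum_mul_left]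
  refine mul_le_mul' le_rfl (le_of_eq ?_)
  rw [← (Equiv.subRight (1 + n : ℤ)).tsum_eq (fun k => u k ^ s)]
  simp [sub_sub]

/-- lower bound for the Lorentz integral -/
lemma lorentz_lower {α : Type*} [MeasurableSpace α] (μ : Measure α) (p q V N : ℝ)
    (hp : 0 < p) (hq : 0 < q) (hV : 0 < V) (hN : 1 < N) :
    ∃ C : ℝ≥0, ∀ f : α → ℂ,
      ∑' k : ℤ, (ENNReal.ofReal ((V * N ^ k) ^ (1/p)) * rearrangement μ f (V * N ^ k)) ^ q ≤
      C * ∫⁻ t in Ioi (0:ℝ),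
        (ENNReal.ofReal (t ^ (1/p)) * rearrangement μ f t) ^ q / ENNReal.ofReal t := by
  have hN0 : 0 < N := by linarith
  set τ : ℤ → ℝ := fun k => V * N ^ k with hτ
  have hτ0 : ∀ k, 0 < τ k := fun k => by positivity
  have hτs : ∀ k, τ k = N * τ (k-1) := fun k => by
    simp only [hτ]; rw [zpow_sub_one₀ hN0.ne']; field_simp
  have hτm : Monotone τ := by
    intro i j hij
    exact mul_le_mul_of_nonneg_left (zpow_le_zpow_right₀ hN.le hij) hV.le
  set c : ℝ := N ^ (q/p) * (N / (N - 1)) with hc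
  have hc0 : 0 < c := by
    have : 0 < N - 1 := by linarith
    positivity
  refine ⟨c.toNNReal, fun f => ?_⟩
  have hpiece : ∀ k : ℤ, (ENNReal.ofReal (τ k ^ (1/p)) * rearrangement μ f (τ k)) ^ q ≤
      ENNReal.ofReal c * ∫⁻ t in Ioc (τ (k-1)) (τ k),
        (ENNReal.ofReal (t ^ (1/p)) * rearrangement μ f t) ^ q / ENNReal.ofReal t := by
    intro k
    have h1 : ∫⁻ t in Ioc (τ (k-1)) (τ k),
        (ENNReal.ofReal (τ (k-1) ^ (1/p)) * rearrangement μ f (τ k)) ^ q / ENNReal.ofReal (τ k) ≤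
        ∫⁻ t in Ioc (τ (k-1)) (τ k),
        (ENNReal.ofReal (t ^ (1/p)) * rearrangement μ f t) ^ q / ENNReal.ofReal t := by
      refine setLIntegral_mono' measurableSet_Ioc fun t ht => ?_
      refine ENNReal.div_le_div (ENNReal.rpow_le_rpow (mul_le_mul' ?_ ?_) hq.le) ?_
      · exact ENNReal.ofReal_le_ofReal
          (Real.rpow_le_rpow (hτ0 _).le ht.1.le (by positivity))
      · exact rearr_anti μ f ht.2
      · exact ENNReal.ofReal_le_ofReal ht.2
    refine le_trans ?_ (mul_le_mul_right h1 _)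
    rw [setLIntegral_const, Real.volume_Ioc]
    rw [ENNReal.mul_rpow_of_nonneg _ _ hq.le, ENNReal.mul_rpow_of_nonneg _ _ hq.le,
      ENNReal.ofReal_rpow_of_nonneg (by have := hτ0 k; positivity) hq.le,
      ENNReal.ofReal_rpow_of_nonneg (by have := hτ0 (k-1); positivity) hq.le,
      div_eq_mul_inv _ (ENNReal.ofReal (τ k)), ← ENNReal.ofReal_inv_of_pos (hτ0 k)]
    set R := rearrangement μ f (τ k) ^ q
    have hT := hτ0 (k-1)
    have e1 : (τ k ^ (1/p)) ^ q =
        c * (((τ (k-1) ^ (1/p)) ^ q) * ((τ k)⁻¹ * (τ k - τ (k-1)))) := by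
      rw [hτs k, ← Real.rpow_mul (by positivity), ← Real.rpow_mul (by positivity),
        Real.mul_rpow hN0.le hT.le, hc]
      have : N - 1 ≠ 0 := by linarith
      have e : 1 / p * q = q / p := by ring
      rw [e]
      field_simp
    have h2 : 0 ≤ τ k - τ (k-1) := sub_nonneg.2 (hτm (by omega))
    have h3 := hτ0 k
    rw [e1, ENNReal.ofReal_mul hc0.le,
      ENNReal.ofReal_mul (p := (τ (k-1) ^ (1/p)) ^ q) (by positivity),
      ENNReal.ofReal_mul (p := (τ k)⁻¹) (by positivity)]
    apply le_of_eq
    ring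
  refine (ENNReal.tsum_le_tsum hpiece).trans ?_
  rw [ENNReal.tsum_mul_left]
  refine mul_le_mul' le_rfl ?_
  rw [← lintegral_iUnion (fun _ => measurableSet_Ioc)]
  · refine lintegral_mono_set ?_
    intro t ht
    obtain ⟨k, hk⟩ := mem_iUnion.1 ht
    exact (hτ0 _).trans hk.1
  · intro i j hij
    have := hτm.pairwise_disjoint_on_Ioc_pred hij
    simpa [Function.onFun, Order.pred_eq_sub_one] using this

lemma annulus_bound (d : ℕ) (hd : 1 ≤ d) (a r : ℝ)
    (ha1 : 0 < a) (ha2 : a < d) (hr1 : 1 < r) :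
    ∃ V : ℝ, 0 < V ∧ ∃ C : ℝ≥0, ∀ f : Ed d → ℂ, Measurable f → ∀ l : ℤ,
      (∫⁻ x in annulus d l, (‖f x‖₊ : ℝ≥0∞) ^ r * ENNReal.ofReal (‖x‖ ^ (-a))) ≤
      C * ∑' n : ℕ, (ENNReal.ofReal ((2:ℝ) ^ (-a))) ^ n *
        (ENNReal.ofReal ((V * ((2:ℝ) ^ d) ^ (l - 1 - n)) ^ (1/(r * d / ((d : ℝ) - a)))) *
          rearrangement volume f (V * ((2:ℝ) ^ d) ^ (l - 1 - n))) ^ r := by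
  have hd0 : (0:ℝ) < d := by exact_mod_cast hd
  have hr0 : 0 < r := by linarith
  have : Nonempty (Fin d) := ⟨⟨0, hd⟩⟩
  set b : ℝ≥0∞ := volume (Metric.ball (0 : Ed d) 1) with hb
  have hbt : b ≠ ∞ := measure_ball_lt_top.ne
  have hb0 : b ≠ 0 := (Metric.measure_ball_pos volume _ one_pos).ne'
  set V : ℝ := 2 ^ d * b.toReal with hV
  have hV0 : 0 < V := by
    have := ENNReal.toReal_pos hb0 hbt
    positivity
  refine ⟨V, hV0, (2 ^ d * V ^ (a / d)).toNNReal, fun f hf l => ?_⟩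
  have hmeas : MeasurableSet (annulus d l) :=
    (measurableSet_le measurable_const measurable_norm).inter
      (measurableSet_lt measurable_norm measurable_const)
  have hvol : volume (annulus d l) ≤ ENNReal.ofReal (V * ((2:ℝ) ^ d) ^ l) := by
    calc volume (annulus d l) ≤ volume (Metric.ball (0 : Ed d) (2 ^ (l+1))) := by
          refine measure_mono fun x hx => ?_
          simpa using hx.2
      _ = ENNReal.ofReal (((2:ℝ) ^ (l+1)) ^ d) * b := by
          rw [Measure.addHaar_ball _ _ (by positivity)]; simp [hb]
      _ = _ := by
          rw [← ENNReal.ofReal_toReal hbt, ← ENNReal.ofReal_mul (by positivity)]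
          congr 1
          rw [hV, zpow_add_one₀ two_ne_zero, mul_pow, ← zpow_natCast, ← zpow_natCast,
            ← zpow_mul, ← zpow_mul, mul_comm l]
          ring
  let τ : ℕ → ℝ := fun n => V * ((2:ℝ) ^ d) ^ (l - n)
  have hD : (1:ℝ) < 2 ^ d := one_lt_pow₀ (by norm_num) (by omega)
  have hτ : Tendsto τ atTop (𝓝 0) := by
    have h1 : τ = fun n => (V * ((2:ℝ) ^ d) ^ l) * (((2:ℝ) ^ d)⁻¹) ^ n := by
      ext n
      simp only [τ]
      rw [zpow_sub₀ (by positivity), zpow_natCast, inv_pow]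
      ring
    rw [h1]
    have := (tendsto_pow_atTop_nhds_zero_of_lt_one (r := ((2:ℝ) ^ d)⁻¹) (by positivity)
      (inv_lt_one_of_one_lt₀ hD)).const_mul (V * ((2:ℝ) ^ d) ^ l)
    simpa using this
  have hcore := core volume f hf (annulus d l) hmeas r hr0 τ hτ (by simpa [τ] using hvol)
  have h1 : (∫⁻ x in annulus d l, (‖f x‖₊ : ℝ≥0∞) ^ r * ENNReal.ofReal (‖x‖ ^ (-a))) ≤
      (∫⁻ x in annulus d l, (‖f x‖₊ : ℝ≥0∞) ^ r) * ENNReal.ofReal (((2:ℝ)^l) ^ (-a)) := by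
    rw [← lintegral_mul_const _ (by fun_prop)]
    refine setLIntegral_mono' hmeas fun x hx => ?_
    refine mul_le_mul' le_rfl (ENNReal.ofReal_le_ofReal ?_)
    exact Real.rpow_le_rpow_of_nonpos (by positivity) hx.1 (by linarith)
  refine h1.trans ((mul_le_mul' hcore le_rfl).trans ?_)
  rw [← ENNReal.tsum_mul_right, ← ENNReal.tsum_mul_left]
  refine ENNReal.tsum_le_tsum fun n => ?_
  have hk : τ (n+1) = V * ((2:ℝ) ^ d) ^ (l - 1 - n) := by
    simp only [τ]; congr 2; push_cast; ring
  have hk2 : τ n = 2 ^ d * τ (n+1) := by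
    rw [hk]; simp only [τ]
    rw [show l - (n:ℤ) = (l - 1 - n) + 1 by ring, zpow_add_one₀ (by positivity)]
    ring
  rw [← hk]
  have hT : 0 < τ (n+1) := by rw [hk]; positivity
  set R := rearrangement volume f (τ (n+1))
  rw [ENNReal.mul_rpow_of_nonneg _ _ hr0.le, 
    ENNReal.ofReal_rpow_of_nonneg (by positivity) hr0.le, ← ENNReal.ofReal_pow (by positivity)]
  have key : τ n * ((2:ℝ)^l) ^ (-a) ≤ (2 ^ d * V ^ (a / d)) *
      ((((2:ℝ) ^ (-a)) ^ n) * (τ (n+1) ^ (1/(r * d / ((d : ℝ) - a)))) ^ r) := by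
    have hda : (0:ℝ) < d - a := by linarith
    have e0 : (1/(r * d / ((d : ℝ) - a))) * r = 1 - a / d := by
      field_simp
    have e1 : τ (n+1) ^ (a/d) = V ^ (a/d) * 2 ^ (a * (l - 1 - n)) := by
      rw [hk, Real.mul_rpow hV0.le (by positivity)]
      congr 1
      rw [← zpow_natCast, ← zpow_mul, ← Real.rpow_intCast, ← Real.rpow_mul (by norm_num)]
      congr 1
      push_cast
      field_simp
    have e2 : τ (n+1) = τ (n+1) ^ (1 - a/d) * τ (n+1) ^ (a/d) := by
      rw [← Real.rpow_add hT]; simp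
    have e3 : (2:ℝ) ^ (a * (l - 1 - n)) * ((2:ℝ)^l) ^ (-a) ≤ ((2:ℝ) ^ (-a)) ^ n := by
      rw [← Real.rpow_intCast, ← Real.rpow_mul (by norm_num), ← Real.rpow_natCast,
        ← Real.rpow_mul (by norm_num), ← Real.rpow_add (by norm_num)]
      apply Real.rpow_le_rpow_of_exponent_le (by norm_num)
      nlinarith
    rw [← Real.rpow_mul hT.le, e0, hk2]
    set W := τ (n+1) ^ (1 - a/d)
    have hW : 0 < W := Real.rpow_pos_of_pos hT _
    rw [e2, e1]
    calc _ = (2 ^ d * V ^ (a/d) * W) * ((2:ℝ) ^ (a * (l - 1 - n)) * ((2:ℝ)^l) ^ (-a)) := by ring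
      _ ≤ (2 ^ d * V ^ (a/d) * W) * ((2:ℝ) ^ (-a)) ^ n := by gcongr
      _ = _ := by ring
  have hτn : 0 ≤ τ n := by rw [hk2]; positivity
  calc R ^ r * ENNReal.ofReal (τ n) * ENNReal.ofReal (((2:ℝ)^l) ^ (-a))
      = R ^ r * ENNReal.ofReal (τ n * ((2:ℝ)^l) ^ (-a)) := by
        rw [ENNReal.ofReal_mul hτn, mul_assoc]
    _ ≤ R ^ r * ENNReal.ofReal ((2 ^ d * V ^ (a / d)) *
      ((((2:ℝ) ^ (-a)) ^ n) * (τ (n+1) ^ (1/(r * d / ((d : ℝ) - a)))) ^ r)) := by gcongr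
    _ = _ := by
      rw [ENNReal.ofReal_mul (p := 2 ^ d * V ^ (a / d)) (by positivity),
        ENNReal.ofReal_mul (p := ((2:ℝ) ^ (-a)) ^ n) (by positivity)]
      change _ = ENNReal.ofReal _ * _
      ring

/-- Lemma (embedding of Lorentz spaces into weighted Herz-type spaces): for `0 < a < d`,
`1 < r < ∞`, `p = rd/(d-a)`:
(a) `(Σ_l [∫_{𝔄_l} |f|^r |x|^{-a}]^{q/r})^{1/q} ≲ ‖f‖_{L^{p,q}}` for `1 < q < ∞`;
(b) `sup_l (∫_{𝔄_l} |f|^r |x|^{-a})^{1/r} ≲ ‖f‖_{L^{p,∞}}`. -/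
theorem statement9 (d : ℕ) (hd : 1 ≤ d) (a r : ℝ)
    (ha1 : 0 < a) (ha2 : a < d) (hr1 : 1 < r) :
    (∀ q : ℝ, 1 < q →
      ∃ C : ℝ≥0, ∀ f : Ed d → ℂ, Measurable f →
        (∑' l : ℤ,
          ((∫⁻ x in annulus d l, (‖f x‖₊ : ℝ≥0∞) ^ r * ENNReal.ofReal (‖x‖ ^ (-a))) ^ (q / r)))
            ^ (1 / q)
        ≤ C * lorentzNorm volume (r * d / ((d : ℝ) - a)) (ENNReal.ofReal q) f)
    ∧
    (∃ C : ℝ≥0, ∀ f : Ed d → ℂ, Measurable f →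
      (⨆ l : ℤ,
        (∫⁻ x in annulus d l, (‖f x‖₊ : ℝ≥0∞) ^ r * ENNReal.ofReal (‖x‖ ^ (-a))) ^ (1 / r))
      ≤ C * lorentzNorm volume (r * d / ((d : ℝ) - a)) ∞ f) := by
  have hd0 : (0:ℝ) < d := by exact_mod_cast hd
  have hr0 : 0 < r := by linarith
  have hda : (0:ℝ) < d - a := by linarith
  have hD : (1:ℝ) < 2 ^ d := one_lt_pow₀ (by norm_num) (by omega)
  obtain ⟨V, hV, C1, h1⟩ := annulus_bound d hd a r ha1 ha2 hr1
  have hρ : ENNReal.ofReal ((2:ℝ) ^ (-a)) < 1 := by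
    rw [ENNReal.ofReal_lt_one]
    exact Real.rpow_lt_one_of_one_lt_of_neg (by norm_num) (by linarith)
  have hp : 0 < r * d / ((d : ℝ) - a) := by positivity
  set p := r * d / ((d : ℝ) - a) with hpdef
  constructor
  · intro q hq
    have hq0 : 0 < q := by linarith
    have hqr : 0 < q / r := by positivity
    obtain ⟨C2, h2⟩ := conv_bound _ hρ (q / r) hqr
    obtain ⟨C3, h3⟩ := lorentz_lower (volume : Measure (Ed d)) p q V (2 ^ d) hp hq0 hV hD
    refine ⟨((C1 ^ (q / r) * (C2 * C3)) ^ (1 / q) : ℝ≥0), fun f hf => ?_⟩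
    rw [lorentzNorm, if_neg ENNReal.ofReal_ne_top, ENNReal.toReal_ofReal hq0.le,
      ENNReal.coe_rpow_of_nonneg _ (by positivity), ← ENNReal.mul_rpow_of_nonneg _ _ (by positivity)]
    refine ENNReal.rpow_le_rpow ?_ (by positivity)
    refine (ENNReal.tsum_le_tsum fun l => ENNReal.rpow_le_rpow (h1 f hf l) hqr.le).trans ?_
    simp_rw [ENNReal.mul_rpow_of_nonneg _ _ hqr.le]
    rw [ENNReal.tsum_mul_left, ENNReal.coe_mul, ENNReal.coe_mul,
      ENNReal.coe_rpow_of_nonneg _ hqr.le, mul_assoc, mul_assoc]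
    refine mul_le_mul' le_rfl ?_
    refine (h2 (fun k => (ENNReal.ofReal ((V * ((2:ℝ) ^ d) ^ k) ^ (1/p)) *
          rearrangement volume f (V * ((2:ℝ) ^ d) ^ k)) ^ r)).trans ?_
    refine mul_le_mul' le_rfl (le_trans (le_of_eq ?_) (h3 f))
    refine tsum_congr fun k => ?_
    rw [← ENNReal.rpow_mul]
    congr 1
    field_simp
  · set K := (1 - ENNReal.ofReal ((2:ℝ) ^ (-a)))⁻¹ with hK
    have hKt : K ≠ ∞ := ENNReal.inv_ne_top.2 (tsub_pos_of_lt hρ).ne'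
    refine ⟨((C1 * K.toNNReal) ^ (1 / r) : ℝ≥0), fun f hf => iSup_le fun l => ?_⟩
    rw [ENNReal.coe_rpow_of_nonneg _ (by positivity), one_div, ENNReal.rpow_inv_le_iff hr0,
      ENNReal.mul_rpow_of_nonneg _ _ hr0.le, ENNReal.rpow_inv_rpow hr0.ne', ENNReal.coe_mul,
      ENNReal.coe_toNNReal hKt, mul_assoc]
    refine (h1 f hf l).trans (mul_le_mul' le_rfl ?_)
    rw [hK, ← ENNReal.tsum_geometric, ← ENNReal.tsum_mul_right]
    refine ENNReal.tsum_le_tsum fun n => mul_le_mul' le_rfl (ENNReal.rpow_le_rpow ?_ hr0.le)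
    rw [lorentzNorm, if_pos rfl]
    exact le_iSup (fun t : Ioi (0:ℝ) => ENNReal.ofReal ((t : ℝ) ^ (1/p)) *
      rearrangement volume f t) ⟨V * ((2:ℝ) ^ d) ^ (l - 1 - n), by
        simp only [mem_Ioi]; positivity⟩

end
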